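/- arXiv:1903.07635 — 3 statements merged into one kernel-verified Lean document; each statement's English description precedes it below -/
import Mathlib

section
/- Let ε > 0 and let f : ℝ → ℝ be Lebesgue integrable on the interval (−ε, ε). Then the function (x, y) ↦ f(x − y) / (ε − |x − y|) is Lebesgue integrable on the square (0, ε) × (0, ε), and ∫₀^ε ∫₀^ε f(x − y) / (ε − |x − y|) dx dy = ∫_{−ε}^{ε} f(z) dz. -/
open MeasureTheory Set

/-- The push-forward of Lebesgue measure on the square under `(x, y) ↦ x - y`. -/
theorem map_sub_square (ε : ℝ) :
    ((volume : Measure (ℝ × ℝ)).restrict (Ioo (0 : ℝ) ε ×ˢ Ioo (0 : ℝ) ε)).map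
      (fun p : ℝ × ℝ => p.1 - p.2) =
    ((volume : Measure ℝ).restrict (Ioo (-ε) ε)).withDensity
      (fun z => ENNReal.ofReal (ε - |z|)) := by
  have hm : Measurable (fun p : ℝ × ℝ => p.1 - p.2) := by fun_prop
  ext s hs
  have hA : MeasurableSet ((fun p : ℝ × ℝ => p.1 - p.2) ⁻¹' s ∩
      (Ioo (0 : ℝ) ε ×ˢ Ioo (0 : ℝ) ε)) :=
    (hm hs).inter (measurableSet_Ioo.prod measurableSet_Ioo)
  have hT := measurePreserving_add_prod (volume : Measure ℝ) (volume : Measure ℝ)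
  rw [Measure.map_apply hm hs, Measure.restrict_apply (hm hs), withDensity_apply _ hs,
    Measure.restrict_restrict hs, Measure.volume_eq_prod,
    ← hT.measure_preimage hA.nullMeasurableSet, Measure.prod_apply (hT.measurable hA),
    ← lintegral_indicator (hs.inter measurableSet_Ioo)]
  congr 1
  ext z
  by_cases hz : z ∈ s ∩ Ioo (-ε) ε
  · rw [indicator_of_mem hz]
    have : (Prod.mk z ⁻¹' ((fun z : ℝ × ℝ => (z.1 + z.2, z.2)) ⁻¹'
        ((fun p : ℝ × ℝ => p.1 - p.2) ⁻¹' s ∩ (Ioo (0 : ℝ) ε ×ˢ Ioo (0 : ℝ) ε)))) =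
        Ioo (max 0 (-z)) (min ε (ε - z)) := by
      ext y
      simp only [mem_preimage, mem_inter_iff, mem_prod, mem_Ioo, add_sub_cancel_right, hz.1,
        true_and, max_lt_iff, lt_min_iff]
      constructor
      · rintro ⟨⟨h1, h2⟩, h3, h4⟩
        refine ⟨⟨?_, ?_⟩, ?_, ?_⟩ <;> linarith
      · rintro ⟨⟨h1, h2⟩, h3, h4⟩
        refine ⟨⟨?_, ?_⟩, ?_, ?_⟩ <;> linarith
    rw [this, Real.volume_Ioo]
    congr 1
    rcases le_total 0 z with h | h
    · rw [abs_of_nonneg h, max_eq_left (by linarith), min_eq_right (by linarith)]; ring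
    · rw [abs_of_nonpos h, max_eq_right (by linarith), min_eq_left (by linarith)]
  · rw [indicator_of_notMem hz]
    convert measure_empty (μ := (volume : Measure ℝ))
    ext y
    simp only [mem_preimage, mem_inter_iff, mem_prod, mem_Ioo, add_sub_cancel_right,
      mem_empty_iff_false, iff_false]
    rintro ⟨h0, ⟨h1, h2⟩, h3, h4⟩
    exact hz ⟨h0, by linarith, by linarith⟩

/-- Lemma "change of variables": for `f` integrable on `(-ε, ε)`, the function
`(x, y) ↦ f (x - y) / (ε - |x - y|)` is integrable on the open square `(0, ε) × (0, ε)`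
and its integral equals `∫_{-ε}^{ε} f`. -/
theorem change_of_variables_lemma (ε : ℝ) (hε : 0 < ε) (f : ℝ → ℝ)
    (hf : IntegrableOn f (Ioo (-ε) ε)) :
    IntegrableOn (fun p : ℝ × ℝ => f (p.1 - p.2) / (ε - |p.1 - p.2|))
      (Ioo (0 : ℝ) ε ×ˢ Ioo (0 : ℝ) ε) ∧
    ∫ p in Ioo (0 : ℝ) ε ×ˢ Ioo (0 : ℝ) ε, f (p.1 - p.2) / (ε - |p.1 - p.2|) =
      ∫ z in Ioo (-ε) ε, f z := by
  have hm : Measurable (fun p : ℝ × ℝ => p.1 - p.2) := by fun_prop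
  have hd : Measurable (fun z : ℝ => ENNReal.ofReal (ε - |z|)) := by fun_prop
  have hmap := map_sub_square ε
  have hlt : ∀ᵐ z ∂((volume : Measure ℝ).restrict (Ioo (-ε) ε)),
      ENNReal.ofReal (ε - |z|) < ⊤ := Filter.Eventually.of_forall fun _ => ENNReal.ofReal_lt_top
  have hae : (fun z => (ENNReal.ofReal (ε - |z|)).toReal • (f z / (ε - |z|)))
      =ᵐ[(volume : Measure ℝ).restrict (Ioo (-ε) ε)] f := by
    filter_upwards [ae_restrict_mem measurableSet_Ioo] with z hz
    have : 0 < ε - |z| := sub_pos.2 (abs_lt.2 hz)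
    rw [ENNReal.toReal_ofReal this.le, smul_eq_mul]
    field_simp
  have hint : Integrable (fun z => f z / (ε - |z|))
      (((volume : Measure ℝ).restrict (Ioo (-ε) ε)).withDensity
        (fun z => ENNReal.ofReal (ε - |z|))) :=
    (integrable_withDensity_iff_integrable_smul' hd hlt).2 (Integrable.congr hf hae.symm)
  have hint' := hint
  rw [← hmap] at hint'
  refine ⟨(integrable_map_measure hint'.aestronglyMeasurable hm.aemeasurable).1 hint', ?_⟩
  rw [← integral_congr_ae hae, ← integral_withDensity_eq_integral_toReal_smul hd hlt, ← hmap,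
    integral_map hm.aemeasurable hint'.aestronglyMeasurable]
end

section
/- Let h > 0 and ε > 0. For t > 2ε define S(t) = Σ_{k = 0}^{⌊t/(2ε)⌋ − 1} 2ε · e^{h(t − (2k + 1)ε)} / (t − (2k + 1)ε); note that every argument t − (2k + 1)ε occurring in this sum is ≥ ε, so all denominators are positive. Then liminf_{t → ∞} S(t) / (e^{ht}/(ht)) ≥ e^{−hε} and limsup_{t → ∞} S(t) / (e^{ht}/(ht)) ≤ e^{hε}. -/
open Filter Real

theorem li_tendsto (h ε : ℝ) (hh : 0 < h) (hε : 0 < ε) :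
    Tendsto (fun t : ℝ =>
        (∑ k ∈ Finset.range ⌊t / (2 * ε)⌋₊,
            2 * ε * Real.exp (h * (t - (2 * (k : ℝ) + 1) * ε)) / (t - (2 * (k : ℝ) + 1) * ε)) /
          (Real.exp (h * t) / (h * t))) atTop
      (nhds (2 * ε * h * Real.exp (-(h * ε)) * (1 - Real.exp (-(2 * (h * ε))))⁻¹)) := by
  have hx : 0 < h * ε := mul_pos hh hε
  set r : ℝ := Real.exp (-(2 * (h * ε))) with hr
  have r0 : 0 < r := Real.exp_pos _
  have r1 : r < 1 := by rw [hr, Real.exp_lt_one_iff]; linarith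
  have hpow : ∀ k : ℕ, Real.exp (-(h * ((2 * (k : ℝ) + 1) * ε)))
      = Real.exp (-(h * ε)) * r ^ k := by
    intro k
    rw [hr, ← Real.exp_nat_mul, ← Real.exp_add]
    congr 1
    ring
  set C : ℝ := 2 * ε * h * Real.exp (-(h * ε)) with hC
  have C0 : 0 < C := by positivity
  let f : ℝ → ℕ → ℝ := fun t k =>
    if k < ⌊t / (2 * ε)⌋₊ then C * r ^ k * (t / (t - (2 * (k : ℝ) + 1) * ε)) else 0
  have hsum : ∑' k : ℕ, C * r ^ k = C * (1 - r)⁻¹ := by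
    rw [tsum_mul_left, tsum_geometric_of_lt_one r0.le r1]
  have hbs : Summable (fun k : ℕ => C * r ^ k * (2 * (k : ℝ) + 2)) := by
    have h1 : Summable (fun k : ℕ => (k : ℝ) ^ 1 * r ^ k) :=
      summable_pow_mul_geometric_of_norm_lt_one 1
        (by rw [Real.norm_eq_abs, abs_of_pos r0]; exact r1)
    have h2 : Summable (fun k : ℕ => r ^ k) := summable_geometric_of_lt_one r0.le r1
    refine ((h1.mul_left (2 * C)).add (h2.mul_left (2 * C))).congr ?_
    intro k
    ring
  have key : ∀ t : ℝ, 0 < t → ∀ k : ℕ, k < ⌊t / (2 * ε)⌋₊ →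
      ε ≤ t - (2 * (k : ℝ) + 1) * ε := by
    intro t ht k hk
    have h1 : (k : ℝ) + 1 ≤ t / (2 * ε) := by
      have h2 : ((k + 1 : ℕ) : ℝ) ≤ (⌊t / (2 * ε)⌋₊ : ℝ) := by exact_mod_cast hk
      push_cast at h2
      exact h2.trans (Nat.floor_le (by positivity))
    rw [le_div_iff₀ (by positivity)] at h1
    linarith
  have hlim : Tendsto (fun t => ∑' k, f t k) atTop (nhds (∑' k : ℕ, C * r ^ k)) := by
    refine tendsto_tsum_of_dominated_convergence hbs ?_ ?_
    · intro k
      have h1 : Tendsto (fun t : ℝ => t / (t - (2 * (k : ℝ) + 1) * ε)) atTop (nhds 1) := by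
        set s := (2 * (k : ℝ) + 1) * ε
        have h2 : Tendsto (fun t : ℝ => 1 + s / (t - s)) atTop (nhds (1 + 0)) :=
          tendsto_const_nhds.add
            (tendsto_const_nhds.div_atTop (tendsto_atTop_add_const_right _ (-s) tendsto_id))
        rw [add_zero] at h2
        refine h2.congr' ?_
        filter_upwards [eventually_gt_atTop s] with t ht
        have : t - s ≠ 0 := (sub_pos.2 ht).ne'
        field_simp
        ring
      have h3 := h1.const_mul (C * r ^ k)
      rw [mul_one] at h3
      refine h3.congr' ?_
      filter_upwards [eventually_ge_atTop (((k : ℝ) + 1) * (2 * ε))] with t ht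
      have : k < ⌊t / (2 * ε)⌋₊ := by
        apply Nat.lt_of_succ_le
        apply Nat.le_floor
        rw [le_div_iff₀ (by positivity)]
        push_cast
        exact ht
      simp only [f, if_pos this]
    · filter_upwards [eventually_gt_atTop 0] with t ht k
      by_cases hk : k < ⌊t / (2 * ε)⌋₊
      · simp only [f, if_pos hk]
        have hd := key t ht k hk
        have hd0 := hε.trans_le hd
        rw [Real.norm_of_nonneg (by positivity)]
        refine mul_le_mul_of_nonneg_left ?_ (by positivity)
        rw [div_le_iff₀ hd0]
        have hk0 : (0 : ℝ) ≤ k := Nat.cast_nonneg k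
        nlinarith [mul_nonneg (by positivity : (0 : ℝ) ≤ 2 * k + 1) (sub_nonneg.2 hd)]
      · simp only [f, if_neg hk, norm_zero]
        positivity
  rw [hsum] at hlim
  refine hlim.congr' ?_
  filter_upwards [eventually_gt_atTop 0] with t ht
  rw [tsum_eq_sum (s := Finset.range ⌊t / (2 * ε)⌋₊), Finset.sum_div]
  · refine Finset.sum_congr rfl fun k hk => ?_
    rw [Finset.mem_range] at hk
    have hd0 := hε.trans_le (key t ht k hk)
    simp only [f, if_pos hk]
    have he : Real.exp (h * (t - (2 * (k : ℝ) + 1) * ε))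
        = Real.exp (h * t) * (Real.exp (-(h * ε)) * r ^ k) := by
      rw [← hpow, ← Real.exp_add]
      congr 1
      ring
    rw [he, hC]
    have := Real.exp_pos (h * t)
    field_simp
  · intro k hk
    rw [Finset.mem_range] at hk
    simp only [f, if_neg hk]

/-- Lemma "li(x)": comparing the Riemann-type sum
`S(t) = ∑_{k=0}^{⌊t/(2ε)⌋ - 1} 2ε e^{h(t-(2k+1)ε)}/(t-(2k+1)ε)` with `e^{ht}/(ht)`:
the liminf of the ratio is at least `e^{-hε}` and the limsup is at most `e^{hε}`. -/
theorem li_lemma (h ε : ℝ) (hh : 0 < h) (hε : 0 < ε) :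
    Real.exp (-(h * ε)) ≤ Filter.liminf (fun t : ℝ =>
        (∑ k ∈ Finset.range ⌊t / (2 * ε)⌋₊,
            2 * ε * Real.exp (h * (t - (2 * (k : ℝ) + 1) * ε)) / (t - (2 * (k : ℝ) + 1) * ε)) /
          (Real.exp (h * t) / (h * t))) Filter.atTop ∧
    Filter.limsup (fun t : ℝ =>
        (∑ k ∈ Finset.range ⌊t / (2 * ε)⌋₊,
            2 * ε * Real.exp (h * (t - (2 * (k : ℝ) + 1) * ε)) / (t - (2 * (k : ℝ) + 1) * ε)) /
          (Real.exp (h * t) / (h * t))) Filter.atTop ≤ Real.exp (h * ε) := by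
  have hx : 0 < h * ε := mul_pos hh hε
  have hl := li_tendsto h ε hh hε
  have r1 : Real.exp (-(2 * (h * ε))) < 1 := by rw [Real.exp_lt_one_iff]; linarith
  have hp := Real.exp_pos (-(h * ε))
  rw [hl.liminf_eq, hl.limsup_eq, ← div_eq_mul_inv]
  constructor
  · rw [le_div_iff₀ (by linarith)]
    have := Real.add_one_le_exp (-(2 * (h * ε)))
    nlinarith
  · rw [div_le_iff₀ (by linarith)]
    have h1 := Real.add_one_le_exp (2 * (h * ε))
    have h2 : Real.exp (h * ε) = Real.exp (-(h * ε)) * Real.exp (2 * (h * ε)) := by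
      rw [← Real.exp_add]; congr 1; ring
    have h3 : Real.exp (2 * (h * ε)) * Real.exp (-(2 * (h * ε))) = 1 := by
      rw [← Real.exp_add]; simp
    rw [h2]
    have h4 : Real.exp (-(h * ε)) * Real.exp (2 * (h * ε)) * (1 - Real.exp (-(2 * (h * ε))))
        = Real.exp (-(h * ε)) * (Real.exp (2 * (h * ε)) - 1) := by
      linear_combination (-Real.exp (-(h * ε))) * h3
    rw [h4]
    nlinarith
end

section
/- Let I be a countable index set, ℓ : I → ℝ a function, and h ≥ 0 a real number such that for every s > h the series Σ_{i ∈ I} e^{−s·ℓ(i)} converges (is finite). Then for every t ∈ ℝ the set {i ∈ I : ℓ(i) ≤ t} is finite, and for every h' > h, lim_{t → ∞} e^{−h' t} · #{i ∈ I : ℓ(i) ≤ t} = 0. -/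
open Filter Set

/-- Lemma "Patterson upper bound" (abstract counting form): if `∑_i e^{-s ℓ(i)}` converges
for every `s > h`, then each sublevel set `{i : ℓ(i) ≤ t}` is finite and, for every
`h' > h`, `e^{-h' t} · #{i : ℓ(i) ≤ t} → 0` as `t → ∞`. -/
theorem patterson_upper_bound {I : Type*} [Countable I] (ℓ : I → ℝ) (h : ℝ) (hh : 0 ≤ h)
    (hsum : ∀ s > h, Summable (fun i : I => Real.exp (-s * ℓ i))) :
    (∀ t : ℝ, {i : I | ℓ i ≤ t}.Finite) ∧
    ∀ h' > h, Filter.Tendsto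
      (fun t : ℝ => Real.exp (-h' * t) * ({i : I | ℓ i ≤ t}.ncard : ℝ))
      Filter.atTop (nhds 0) := by
  have hfin : ∀ t : ℝ, {i : I | ℓ i ≤ t}.Finite := by
    intro t
    have h1 := (hsum (h + 1) (by linarith)).tendsto_cofinite_zero
    have h2 := h1.eventually (gt_mem_nhds (Real.exp_pos (-(h + 1) * t)))
    refine (Filter.eventually_cofinite.mp h2).subset ?_
    intro i hi
    simp only [Set.mem_setOf_eq] at hi ⊢
    rw [not_lt, Real.exp_le_exp]
    nlinarith
  refine ⟨hfin, ?_⟩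
  intro h' hh'
  obtain ⟨s, hs1, hs2⟩ := exists_between hh'
  have hS := hsum s hs1
  set S := ∑' i, Real.exp (-s * ℓ i) with hSdef
  have key : ∀ t : ℝ, Real.exp (-s * t) * ({i : I | ℓ i ≤ t}.ncard : ℝ) ≤ S := by
    intro t
    have h1 := hS.sum_le_tsum (hfin t).toFinset (fun i _ => (Real.exp_pos _).le)
    refine le_trans ?_ h1
    rw [Set.ncard_eq_toFinset_card _ (hfin t), mul_comm, ← nsmul_eq_mul]
    refine Finset.card_nsmul_le_sum _ _ _ ?_
    intro i hi
    have hi' : ℓ i ≤ t := by simpa using hi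
    rw [Real.exp_le_exp]
    nlinarith
  have hlim : Filter.Tendsto (fun t : ℝ => Real.exp (-((h' - s) * t)) * S)
      Filter.atTop (nhds 0) := by
    have h1 : Filter.Tendsto (fun t : ℝ => (h' - s) * t) Filter.atTop Filter.atTop :=
      Filter.tendsto_id.const_mul_atTop (by linarith)
    simpa using (Real.tendsto_exp_neg_atTop_nhds_zero.comp h1).mul_const S
  refine squeeze_zero (fun t => by positivity) (fun t => ?_) hlim
  have h2 : Real.exp (-h' * t) = Real.exp (-((h' - s) * t)) * Real.exp (-s * t) := by
    rw [← Real.exp_add]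
    congr 1
    ring
  rw [h2, mul_assoc]
  exact mul_le_mul_of_nonneg_left (key t) (Real.exp_pos _).le
end
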